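/- Let μ be a σ-finite measure with μ(T) > 0, let φ be a continuously differentiable deformed exponential, let u₀ : T → (0,∞) satisfy condition (C), and let p, q ∈ P_μ. Let κ : (0,1) → [0,∞) be the function determined by ∫_T φ(α·φ⁻¹(p) + (1−α)·φ⁻¹(q) + κ(α)·u₀) dμ = 1 for each α ∈ (0,1). If there exists α₀ < 0 such that ∫_T φ(α·φ⁻¹(p) + (1−α)·φ⁻¹(q)) dμ < ∞ for all α ∈ [α₀, 0), then the limit D_φ^{(0)}(p‖q) := lim_{α↓0} κ(α)/(α(1−α)) exists, is finite, and equals the φ-divergence D_φ(q‖p) = (∫_T (φ⁻¹(q) − φ⁻¹(p))/(φ⁻¹)'(q) dμ) / (∫_T u₀/(φ⁻¹)'(q) dμ). -/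

import Mathlib

open MeasureTheory Filter Set

lemma aux_mono (φ : ℝ → ℝ) (hconv : ConvexOn ℝ Set.univ φ) (hnonneg : ∀ u, 0 ≤ φ u)
    (hbot : Tendsto φ atBot (nhds 0)) : Monotone φ := by
  intro x y hxy
  by_contra! h
  have hlt : x < y := lt_of_le_of_ne hxy (by rintro rfl; exact lt_irrefl _ h)
  have hpos : 0 < φ x := lt_of_le_of_lt (hnonneg y) h
  obtain ⟨z, hz, hzx⟩ := ((hbot.eventually (gt_mem_nhds hpos)).and (eventually_lt_atBot x)).exists
  have h1 := hconv.slope_mono_adjacent (mem_univ z) (mem_univ y) hzx hlt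
  have h2 : 0 < (φ x - φ z) / (x - z) := div_pos (by linarith) (by linarith)
  have h3 : (φ y - φ x) / (y - x) < 0 := div_neg_of_neg_of_pos (by linarith) (by linarith)
  linarith

lemma aux_deriv_pos (φ : ℝ → ℝ) (hconv : ConvexOn ℝ Set.univ φ)
    (hbot : Tendsto φ atBot (nhds 0)) (hsmooth : ContDiff ℝ 1 φ) (x : ℝ) (hx : 0 < φ x) :
    0 < deriv φ x := by
  obtain ⟨z, hz, hzx⟩ := ((hbot.eventually (gt_mem_nhds hx)).and (eventually_lt_atBot x)).exists
  have h1 := hconv.slope_le_deriv (mem_univ z) (mem_univ x) hzx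
    ((hsmooth.differentiable (by norm_num)) x)
  refine lt_of_lt_of_le ?_ h1
  rw [slope_def_field]
  exact div_pos (by linarith) (by linarith)

lemma aux_inv (φ : ℝ → ℝ) (hconv : ConvexOn ℝ Set.univ φ)
    (hbot : Tendsto φ atBot (nhds 0)) (hsmooth : ContDiff ℝ 1 φ)
    (φinv : ℝ → ℝ) (hinv₁ : ∀ v : ℝ, 0 < v → φ (φinv v) = v)
    (hinv₂ : ∀ u : ℝ, 0 < φ u → φinv (φ u) = u) (v : ℝ) (hv : 0 < v) :
    HasDerivAt φinv (deriv φ (φinv v))⁻¹ v := by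
  have hp : 0 < φ (φinv v) := by rw [hinv₁ v hv]; exact hv
  have h := (hsmooth.contDiffAt (x := φinv v)).hasStrictDerivAt (by norm_num)
  have h2 := h.to_local_left_inverse (g := φinv)
    (aux_deriv_pos φ hconv hbot hsmooth _ hp).ne'
    ((hsmooth.continuous.continuousAt.eventually (lt_mem_nhds hp)).mono fun x hx => hinv₂ x hx)
  rw [hinv₁ v hv] at h2
  exact h2.hasDerivAt

lemma aux_lim {T : Type*} [MeasurableSpace T] (μ : Measure T)
    (φ : ℝ → ℝ) (hconv : ConvexOn ℝ Set.univ φ) (hnonneg : ∀ u, 0 ≤ φ u)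
    (hsmooth : ContDiff ℝ 1 φ) (a e : T → ℝ) (ha : Measurable a) (he : Measurable e)
    (r : ℝ) (hr : 0 < r) (h0 : Integrable (fun t => φ (a t)) μ)
    (h1 : Integrable (fun t => φ (a t + r * e t)) μ)
    (h2 : Integrable (fun t => φ (a t + (-r) * e t)) μ) :
    Integrable (fun t => deriv φ (a t) * e t) μ ∧
    (∀ α, 0 < α → α ≤ r → Integrable (fun t => φ (a t + α * e t)) μ) ∧
    Tendsto (fun α : ℝ => ((∫ t, φ (a t + α * e t) ∂μ) - ∫ t, φ (a t) ∂μ) / α)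
      (nhdsWithin 0 (Set.Ioi 0)) (nhds (∫ t, deriv φ (a t) * e t ∂μ)) := by
  have hcont := hsmooth.continuous
  have hdc : Continuous (deriv φ) := hsmooth.continuous_deriv (by norm_num)
  have hg : ∀ t, ConvexOn ℝ univ (fun α : ℝ => φ (a t + α * e t)) := by
    intro t
    refine ⟨convex_univ, fun x _ y _ c d hc hd hcd => ?_⟩
    have := hconv.2 (mem_univ (a t + x * e t)) (mem_univ (a t + y * e t)) hc hd hcd
    convert this using 2
    simp only [smul_eq_mul]
    linear_combination (-a t) * hcd
  set bd : T → ℝ := fun t => |(φ (a t + r * e t) - φ (a t)) / r| +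
    |(φ (a t + (-r) * e t) - φ (a t)) / (-r)| with hbd
  have hbdint : Integrable bd μ :=
    ((h1.sub h0).div_const r).abs.add ((h2.sub h0).div_const (-r)).abs
  have hbound : ∀ α, 0 < α → α ≤ r → ∀ t, |(φ (a t + α * e t) - φ (a t)) / α| ≤ bd t := by
    intro α hα hαr t
    have u := (hg t).secant_mono (a := 0) (mem_univ _) (mem_univ α) (mem_univ r) hα.ne' hr.ne' hαr
    have l := (hg t).secant_mono (a := 0) (mem_univ _) (mem_univ (-r)) (mem_univ α)
      (by linarith) hα.ne' (by linarith)
    simp only [zero_mul, add_zero, sub_zero] at u l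
    simp only [hbd]
    rw [abs_le]
    constructor
    · have := neg_abs_le ((φ (a t + (-r) * e t) - φ (a t)) / (-r))
      have := abs_nonneg ((φ (a t + r * e t) - φ (a t)) / r)
      linarith
    · have := abs_nonneg ((φ (a t + (-r) * e t) - φ (a t)) / (-r))
      have := le_abs_self ((φ (a t + r * e t) - φ (a t)) / r)
      linarith
  have hpt : ∀ t, Tendsto (fun α : ℝ => (φ (a t + α * e t) - φ (a t)) / α)
      (nhdsWithin 0 (Set.Ioi 0)) (nhds (deriv φ (a t) * e t)) := by
    intro t
    have hd : HasDerivAt (fun α : ℝ => φ (a t + α * e t)) (deriv φ (a t) * e t) 0 := by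
      have i : HasDerivAt (fun α : ℝ => a t + α * e t) (e t) 0 := by
        simpa using ((hasDerivAt_id (0:ℝ)).mul_const (e t)).const_add (a t)
      have o : HasDerivAt φ (deriv φ (a t)) (a t + 0 * e t) := by
        simpa using ((hsmooth.differentiable (by norm_num)) (a t)).hasDerivAt
      exact o.comp 0 i
    have := hd.tendsto_slope_zero_right
    refine this.congr fun α => ?_
    simp [div_eq_inv_mul]
  have hev : ∀ᶠ α : ℝ in nhdsWithin 0 (Set.Ioi 0), 0 < α ∧ α ≤ r :=
    (Ioc_mem_nhdsGT hr)
  have hmeas : ∀ α : ℝ, Measurable fun t => φ (a t + α * e t) := fun α =>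
    hcont.measurable.comp (ha.add (he.const_mul α))
  have hint : ∀ α, 0 < α → α ≤ r → Integrable (fun t => φ (a t + α * e t)) μ := by
    intro α hα hαr
    have : Integrable (fun t => (φ (a t + α * e t) - φ (a t)) / α) μ :=
      hbdint.mono' (((hmeas α).sub (hcont.measurable.comp ha)).div_const α).aestronglyMeasurable
        (ae_of_all _ fun t => by rw [Real.norm_eq_abs]; exact hbound α hα hαr t)
    refine ((this.mul_const α).add h0).congr (ae_of_all _ fun t => ?_)
    simp only [Pi.add_apply]
    field_simp
    ring
  refine ⟨?_, hint, ?_⟩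
  · refine hbdint.mono' ((hdc.measurable.comp ha).mul he).aestronglyMeasurable
      (ae_of_all _ fun t => ?_)
    rw [Real.norm_eq_abs]
    exact le_of_tendsto (hpt t).abs (hev.mono fun α h => hbound α h.1 h.2 t)
  · have := tendsto_integral_filter_of_dominated_convergence (μ := μ)
      (F := fun (α : ℝ) t => (φ (a t + α * e t) - φ (a t)) / α) bd
      (Eventually.of_forall fun α =>
        (((hmeas α).sub (hcont.measurable.comp ha)).div_const α).aestronglyMeasurable)
      (hev.mono fun α h => ae_of_all _ fun t => by
        rw [Real.norm_eq_abs]; exact hbound α h.1 h.2 t)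
      hbdint (ae_of_all _ hpt)
    refine this.congr' (hev.mono fun α h => ?_)
    simp only
    rw [integral_div, integral_sub (hint α h.1 h.2) h0]

/-- With `μ` σ-finite, `μ(T) > 0`, `φ` a continuously differentiable
deformed exponential with inverse `φinv`, `u₀` satisfying condition (C), `p, q ∈ P_μ`,
and `κ : (0,1) → [0,∞)` determined by
`∫ φ(α φ⁻¹(p) + (1−α) φ⁻¹(q) + κ(α) u₀) dμ = 1`: if there is `α₀ < 0` such that
`∫ φ(α φ⁻¹(p) + (1−α) φ⁻¹(q)) dμ < ∞` for all `α ∈ [α₀, 0)`, then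
`lim_{α↓0} κ(α)/(α(1−α))` exists, is finite, and equals
`D_φ(q‖p) = (∫ (φ⁻¹(q) − φ⁻¹(p))/(φ⁻¹)'(q) dμ) / (∫ u₀/(φ⁻¹)'(q) dμ)`. -/
theorem renyi_limit_at_zero
    {T : Type*} [MeasurableSpace T] (μ : Measure T) [SigmaFinite μ]
    (hμpos : 0 < μ Set.univ)
    (φ : ℝ → ℝ) (hconv : ConvexOn ℝ Set.univ φ) (hnonneg : ∀ u, 0 ≤ φ u)
    (hbot : Tendsto φ atBot (nhds 0)) (htop : Tendsto φ atTop atTop)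
    (hsmooth : ContDiff ℝ 1 φ)
    (φinv : ℝ → ℝ) (hinv₁ : ∀ v : ℝ, 0 < v → φ (φinv v) = v)
    (hinv₂ : ∀ u : ℝ, 0 < φ u → φinv (φ u) = u)
    (u₀ : T → ℝ) (hu₀meas : Measurable u₀) (hu₀pos : ∀ t, 0 < u₀ t)
    (hC : ∀ c : T → ℝ, Measurable c →
      (∫⁻ t, ENNReal.ofReal (φ (c t)) ∂μ < ⊤) →
      ∀ lam : ℝ, 0 < lam → ∫⁻ t, ENNReal.ofReal (φ (c t + lam * u₀ t)) ∂μ < ⊤)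
    (p : T → ℝ) (hpmeas : Measurable p) (hppos : ∀ᵐ t ∂μ, 0 < p t)
    (hpint : ∫⁻ t, ENNReal.ofReal (p t) ∂μ = 1)
    (q : T → ℝ) (hqmeas : Measurable q) (hqpos : ∀ᵐ t ∂μ, 0 < q t)
    (hqint : ∫⁻ t, ENNReal.ofReal (q t) ∂μ = 1)
    (κ : ℝ → ℝ)
    (hκ : ∀ α ∈ Set.Ioo (0 : ℝ) 1, 0 ≤ κ α ∧
      ∫⁻ t, ENNReal.ofReal
        (φ (α * φinv (p t) + (1 - α) * φinv (q t) + κ α * u₀ t)) ∂μ = 1)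
    (α₀ : ℝ) (hα₀ : α₀ < 0)
    (hfin : ∀ α : ℝ, α₀ ≤ α → α < 0 →
      ∫⁻ t, ENNReal.ofReal (φ (α * φinv (p t) + (1 - α) * φinv (q t))) ∂μ < ⊤) :
    Tendsto (fun α : ℝ => κ α / (α * (1 - α))) (nhdsWithin 0 (Set.Ioi 0))
      (nhds ((∫ t, (φinv (q t) - φinv (p t)) / deriv φinv (q t) ∂μ) /
             (∫ t, u₀ t / deriv φinv (q t) ∂μ))) := by
  have hmono := aux_mono φ hconv hnonneg hbot
  have hcont := hsmooth.continuous
  have hder := aux_inv φ hconv hbot hsmooth φinv hinv₁ hinv₂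
  have hψm : Measurable (fun v : ℝ => if 0 < v then φinv v else 0) := by
    have : Measurable ((Ioi (0:ℝ)).piecewise φinv (fun _ => (0:ℝ))) :=
      ContinuousOn.measurable_piecewise
        (fun v hv => (hder v hv).continuousAt.continuousWithinAt)
        continuousOn_const measurableSet_Ioi
    convert this using 2
    simp [Set.piecewise]
  set a : T → ℝ := fun t => if 0 < q t then φinv (q t) else 0 with ha_def
  set b : T → ℝ := fun t => if 0 < p t then φinv (p t) else 0 with hb_def
  have ham : Measurable a := hψm.comp hqmeas
  have hbm : Measurable b := hψm.comp hpmeas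
  have haq : ∀ᵐ t ∂μ, φinv (q t) = a t := by
    filter_upwards [hqpos] with t ht
    simp [ha_def, ht]
  have hbp : ∀ᵐ t ∂μ, φinv (p t) = b t := by
    filter_upwards [hppos] with t ht
    simp [hb_def, ht]
  have hφa : ∀ᵐ t ∂μ, φ (a t) = q t := by
    filter_upwards [hqpos, haq] with t ht h
    rw [← h, hinv₁ _ ht]
  have hφb : ∀ᵐ t ∂μ, φ (b t) = p t := by
    filter_upwards [hppos, hbp] with t ht h
    rw [← h, hinv₁ _ ht]
  -- integrability versus finite lintegral
  have hII : ∀ c : T → ℝ, Measurable c → (∫⁻ t, ENNReal.ofReal (φ (c t)) ∂μ < ⊤) →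
      Integrable (fun t => φ (c t)) μ := fun c hc h =>
    ⟨(hcont.measurable.comp hc).aestronglyMeasurable,
      (hasFiniteIntegral_iff_ofReal (ae_of_all _ fun t => hnonneg _)).2 h⟩
  have hIL : ∀ c : T → ℝ, Integrable (fun t => φ (c t)) μ →
      (∫⁻ t, ENNReal.ofReal (φ (c t)) ∂μ < ⊤) := fun c h =>
      (hasFiniteIntegral_iff_ofReal (ae_of_all _ fun t => hnonneg _)).1 h.2
  have hIC : ∀ c : T → ℝ, Measurable c → Integrable (fun t => φ (c t)) μ → ∀ k : ℝ,
      Integrable (fun t => φ (c t + k * u₀ t)) μ := by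
    intro c hc hi k
    have h1 := hII (fun t => c t + (|k| + 1) * u₀ t) (hc.add (hu₀meas.const_mul _))
      (hC c hc (hIL c hi) (|k| + 1) (by positivity))
    refine h1.mono' (hcont.measurable.comp (hc.add (hu₀meas.const_mul _))).aestronglyMeasurable
      (ae_of_all _ fun t => ?_)
    rw [Real.norm_eq_abs, abs_of_nonneg (hnonneg _)]
    apply hmono
    have := le_abs_self k
    have := hu₀pos t
    nlinarith
  have hIa : Integrable (fun t => φ (a t)) μ := by
    refine hII a ham ?_
    rw [lintegral_congr_ae (g := fun t => ENNReal.ofReal (q t))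
      (hφa.mono fun t h => by simp only [h]), hqint]
    exact ENNReal.one_lt_top
  have hIb : Integrable (fun t => φ (b t)) μ := by
    refine hII b hbm ?_
    rw [lintegral_congr_ae (g := fun t => ENNReal.ofReal (p t))
      (hφb.mono fun t h => by simp only [h]), hpint]
    exact ENNReal.one_lt_top
  have hI1 : ∫ t, φ (a t) ∂μ = 1 := by
    rw [integral_eq_lintegral_of_nonneg_ae (ae_of_all _ fun t => hnonneg _)
      hIa.aestronglyMeasurable, lintegral_congr_ae (g := fun t => ENNReal.ofReal (q t))
      (hφa.mono fun t h => by simp only [h]), hqint]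
    simp
  set d : T → ℝ := fun t => b t - a t with hd_def
  have hdm : Measurable d := hbm.sub ham
  obtain ⟨r, hr, hr1, hr0⟩ : ∃ r : ℝ, 0 < r ∧ r ≤ 1 ∧ α₀ ≤ -r :=
    ⟨min 1 (-α₀), lt_min one_pos (by linarith), min_le_left _ _, by
      have := min_le_right 1 (-α₀); linarith⟩
  have hIr : Integrable (fun t => φ (a t + r * d t)) μ := by
    refine (hIa.add hIb).mono' (hcont.measurable.comp
      (ham.add (hdm.const_mul _))).aestronglyMeasurable (ae_of_all _ fun t => ?_)
    rw [Real.norm_eq_abs, abs_of_nonneg (hnonneg _)]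
    have := hconv.2 (mem_univ (a t)) (mem_univ (b t)) (by linarith : 0 ≤ 1 - r) hr.le (by ring)
    simp only [smul_eq_mul] at this
    have e : a t + r * d t = (1 - r) * a t + r * b t := by simp only [hd_def]; ring
    rw [e]
    simp only [Pi.add_apply]
    nlinarith [hnonneg (a t), hnonneg (b t)]
  have hInr : Integrable (fun t => φ (a t + (-r) * d t)) μ := by
    refine hII _ (ham.add (hdm.const_mul _)) ?_
    refine lt_of_eq_of_lt (lintegral_congr_ae ?_) (hfin (-r) hr0 (by linarith))
    filter_upwards [haq, hbp] with t h1 h2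
    rw [h1, h2]
    congr 2
    simp only [hd_def]
    ring
  have key : ∀ s : ℝ, Integrable (fun t => deriv φ (a t) * (d t + s * u₀ t)) μ ∧
      (∀ α, 0 < α → α ≤ r → Integrable (fun t => φ (a t + α * (d t + s * u₀ t))) μ) ∧
      Tendsto (fun α : ℝ => ((∫ t, φ (a t + α * (d t + s * u₀ t)) ∂μ) - ∫ t, φ (a t) ∂μ) / α)
      (nhdsWithin 0 (Set.Ioi 0)) (nhds (∫ t, deriv φ (a t) * (d t + s * u₀ t) ∂μ)) := by
    intro s
    refine aux_lim μ φ hconv hnonneg hsmooth a (fun t => d t + s * u₀ t) ham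
      (hdm.add (hu₀meas.const_mul _)) r hr hIa ?_ ?_
    · refine (hIC _ (ham.add (hdm.const_mul r)) hIr (r * s)).congr (ae_of_all _ fun t => ?_)
      simp only [Pi.add_apply]
      congr 1
      ring
    · refine (hIC _ (ham.add (hdm.const_mul (-r))) hInr (-r * s)).congr (ae_of_all _ fun t => ?_)
      simp only [Pi.add_apply]
      congr 1
      ring
  have hDd : Integrable (fun t => deriv φ (a t) * d t) μ := by
    simpa using (key 0).1
  have hDu : Integrable (fun t => deriv φ (a t) * u₀ t) μ := by
    refine ((key 1).1.sub hDd).congr (ae_of_all _ fun t => ?_)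
    simp only [Pi.sub_apply]
    ring
  set Id := ∫ t, deriv φ (a t) * d t ∂μ with hId
  set Iu := ∫ t, deriv φ (a t) * u₀ t ∂μ with hIu
  have hIs : ∀ s : ℝ, ∫ t, deriv φ (a t) * (d t + s * u₀ t) ∂μ = Id + s * Iu := by
    intro s
    rw [hId, hIu, ← integral_const_mul, ← integral_add hDd (hDu.const_mul s)]
    congr 1
    ext t
    ring
  have hdpos : ∀ᵐ t ∂μ, 0 < deriv φ (a t) * u₀ t := by
    filter_upwards [hφa, hqpos] with t h1 h2
    exact mul_pos (aux_deriv_pos φ hconv hbot hsmooth _ (by rw [h1]; exact h2)) (hu₀pos t)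
  have hIupos : 0 < Iu := by
    rw [hIu, integral_pos_iff_support_of_nonneg_ae (hdpos.mono fun t h => h.le) hDu]
    have : Function.support (fun t => deriv φ (a t) * u₀ t) =ᵐ[μ] univ := by
      rw [eventuallyEq_univ]
      exact hdpos.mono fun t h => h.ne'
    rw [measure_congr this]
    exact hμpos
  have hderinv : ∀ᵐ t ∂μ, deriv φinv (q t) = (deriv φ (a t))⁻¹ := by
    filter_upwards [haq, hqpos] with t h1 h2
    rw [(hder _ h2).deriv, h1]
  have hnum : ∫ t, (φinv (q t) - φinv (p t)) / deriv φinv (q t) ∂μ = -Id := by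
    rw [hId, ← integral_neg]
    refine integral_congr_ae ?_
    filter_upwards [haq, hbp, hderinv] with t h1 h2 h3
    rw [h1, h2, h3, div_inv_eq_mul]
    simp only [hd_def]
    ring
  have hden : ∫ t, u₀ t / deriv φinv (q t) ∂μ = Iu := by
    rw [hIu]
    refine integral_congr_ae ?_
    filter_upwards [hderinv] with t h3
    rw [h3, div_inv_eq_mul, mul_comm]
  rw [hnum, hden]
  have hev : ∀ᶠ α : ℝ in nhdsWithin 0 (Set.Ioi 0), 0 < α ∧ α < r := Ioo_mem_nhdsGT hr
  -- the normalisation condition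
  have hκ1 : ∀ α, 0 < α → α < r → Integrable (fun t => φ (a t + α * d t + κ α * u₀ t)) μ ∧
      ∫ t, φ (a t + α * d t + κ α * u₀ t) ∂μ = 1 := by
    intro α h1 h2
    have h := (hκ α ⟨h1, by linarith⟩).2
    have h' : ∫⁻ t, ENNReal.ofReal (φ (a t + α * d t + κ α * u₀ t)) ∂μ = 1 := by
      rw [← h]
      refine lintegral_congr_ae ?_
      filter_upwards [haq, hbp] with t h1 h2
      rw [h1, h2]
      congr 2
      simp only [hd_def]
      ring
    have hi := hII (fun t => a t + α * d t + κ α * u₀ t)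
      ((ham.add (hdm.const_mul _)).add (hu₀meas.const_mul _)) (by rw [h']; exact ENNReal.one_lt_top)
    refine ⟨hi, ?_⟩
    rw [integral_eq_lintegral_of_nonneg_ae (ae_of_all _ fun t => hnonneg _)
      hi.aestronglyMeasurable, h']
    simp
  have hlim : Tendsto (fun α : ℝ => κ α / α) (nhdsWithin 0 (Set.Ioi 0)) (nhds (-Id / Iu)) := by
    rw [tendsto_order]
    constructor
    · intro s hs
      have hneg : Id + s * Iu < 0 := by
        rw [lt_div_iff₀ hIupos] at hs; linarith
      have ht := (key s).2.2
      rw [hIs] at ht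
      filter_upwards [ht.eventually (gt_mem_nhds hneg), hev] with α h1 h2
      rw [lt_div_iff₀ h2.1]
      by_contra! hcon
      obtain ⟨hi, he⟩ := hκ1 α h2.1 h2.2
      have hle : ∫ t, φ (a t + α * d t + κ α * u₀ t) ∂μ ≤
          ∫ t, φ (a t + α * (d t + s * u₀ t)) ∂μ :=
        integral_mono hi ((key s).2.1 α h2.1 h2.2.le) fun t => hmono (by
          have := mul_le_mul_of_nonneg_right hcon (hu₀pos t).le
          linarith)
      have : 0 ≤ ((∫ t, φ (a t + α * (d t + s * u₀ t)) ∂μ) - ∫ t, φ (a t) ∂μ) / α :=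
        div_nonneg (by linarith) h2.1.le
      linarith
    · intro s hs
      have hneg : 0 < Id + s * Iu := by
        rw [gt_iff_lt, div_lt_iff₀ hIupos] at hs; linarith
      have ht := (key s).2.2
      rw [hIs] at ht
      filter_upwards [ht.eventually (lt_mem_nhds hneg), hev] with α h1 h2
      rw [div_lt_iff₀ h2.1]
      by_contra! hcon
      obtain ⟨hi, he⟩ := hκ1 α h2.1 h2.2
      have hle : ∫ t, φ (a t + α * (d t + s * u₀ t)) ∂μ ≤
          ∫ t, φ (a t + α * d t + κ α * u₀ t) ∂μ :=
        integral_mono ((key s).2.1 α h2.1 h2.2.le) hi fun t => hmono (by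
          have := mul_le_mul_of_nonneg_right hcon (hu₀pos t).le
          linarith)
      have : ((∫ t, φ (a t + α * (d t + s * u₀ t)) ∂μ) - ∫ t, φ (a t) ∂μ) / α ≤ 0 :=
        div_nonpos_of_nonpos_of_nonneg (by linarith) h2.1.le
      linarith
  have h1α : Tendsto (fun α : ℝ => 1 - α) (nhdsWithin 0 (Set.Ioi 0)) (nhds 1) := by
    have : Tendsto (fun α : ℝ => 1 - α) (nhds 0) (nhds (1 - 0)) :=
      (continuous_const.sub continuous_id).tendsto 0
    rw [sub_zero] at this
    exact this.mono_left nhdsWithin_le_nhds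
  have := hlim.div h1α one_ne_zero
  rw [div_one] at this
  refine this.congr fun α => ?_
  simp only [Pi.div_apply]
  rw [div_div]
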